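/- arXiv:2107.03317 — 7 statements merged into one kernel-verified Lean document; each statement's English description precedes it below -/
import Mathlib

section
/- Let N ≥ 1 and λ_{s,n} > 0 for s ∈ {0,1}, n = 1,…,N, and set λ̄_s = ∑_{n=1}^N λ_{s,n}. Then for every x ∈ ℤ, the sum over all tuples z = (z_{s,n}) ∈ ℕ^{{0,1}×{1,…,N}} satisfying ∑_n z_{0,n} − ∑_n z_{1,n} = x of ∏_{s,n} λ_{s,n}^{z_{s,n}}/z_{s,n}! equals λ̄₀^{max(x,0)} · λ̄₁^{max(−x,0)} · ₀F₁(|x|+1, λ̄₀λ̄₁)/Γ(|x|+1). (This is the reciprocal of the normalization factor D(λ, x) of the diffnomial distribution.) -/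
open Finset in
/-- The multinomial theorem in exponential-generating-function form. -/
lemma sum_piAntidiag_prod_pow_div_factorial {ι : Type*} [Fintype ι] [DecidableEq ι]
    (f : ι → ℝ) (m : ℕ) :
    ∑ u ∈ piAntidiag univ m, ∏ i, f i ^ u i / ((u i).factorial : ℝ)
      = (∑ i, f i) ^ m / (m.factorial : ℝ) := by
  rw [sum_pow_eq_sum_piAntidiag, sum_div]
  refine sum_congr rfl fun u hu ↦ ?_
  have hm : ∑ i, u i = m := (mem_piAntidiag.1 hu).1
  have hspec : (∏ i, ((u i).factorial : ℝ)) * (Nat.multinomial univ u : ℝ)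
      = (m.factorial : ℝ) := by
    rw [← hm]
    exact_mod_cast Nat.multinomial_spec univ u
  have hprod : (∏ i, ((u i).factorial : ℝ)) ≠ 0 :=
    prod_ne_zero_iff.2 fun i _ ↦ by positivity
  rw [prod_div_distrib, div_eq_div_iff hprod (by positivity), ← hspec]
  ring

/-- A series of nonnegative reals may be summed along the fibers of a map; no summability is needed
when every fiber is summable. -/
lemma tsum_fiber_of_nonneg {α β : Type*} {F : α → ℝ} (hF : ∀ z, 0 ≤ F z) (g : α → β)
    (hs : ∀ k, Summable fun z : g ⁻¹' {k} ↦ F z) :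
    ∑' z, F z = ∑' k, ∑' z : g ⁻¹' {k}, F z := by
  have h (k : β) : ENNReal.ofReal (∑' z : g ⁻¹' {k}, F z)
      = ∑' z : g ⁻¹' {k}, ENNReal.ofReal (F z) :=
    ENNReal.ofReal_tsum_of_nonneg (fun z ↦ hF z) (hs k)
  calc ∑' z, F z = ∑' z, (ENNReal.ofReal (F z)).toReal := by
        simp only [ENNReal.toReal_ofReal (hF _)]
    _ = (∑' z, ENNReal.ofReal (F z)).toReal :=
        (ENNReal.tsum_toReal_eq fun _ ↦ ENNReal.ofReal_ne_top).symm
    _ = (∑' k, ENNReal.ofReal (∑' z : g ⁻¹' {k}, F z)).toReal := by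
        simp only [h]
        rw [ENNReal.tsum_fiberwise (fun z ↦ ENNReal.ofReal (F z)) g]
    _ = ∑' k, ∑' z : g ⁻¹' {k}, F z := by
        rw [ENNReal.tsum_toReal_eq fun _ ↦ ENNReal.ofReal_ne_top]
        exact tsum_congr fun k ↦ ENNReal.toReal_ofReal (tsum_nonneg fun z ↦ hF z)

/-- Tuples whose row sums differ by `a - b`, with second row sum exceeding `b` by `k`, are pairs of
rows with sums `a + k` and `b + k`. -/
def rowSumFiberEquiv {N : ℕ} {x : ℤ} {a b : ℕ} (hx : (a : ℤ) - b = x)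
    (hab : a = 0 ∨ b = 0) (k : ℕ) :
    (fun z : {z : Fin 2 × Fin N → ℕ //
        (∑ n : Fin N, (z (0, n) : ℤ)) - ∑ n : Fin N, (z (1, n) : ℤ) = x} ↦
          (∑ n, z.1 (1, n)) - b) ⁻¹' {k}
      ≃ Finset.piAntidiag (Finset.univ : Finset (Fin N)) (a + k)
        × Finset.piAntidiag (Finset.univ : Finset (Fin N)) (b + k) where
  toFun z :=
    have h₁ : ((∑ n, z.1.1 (0, n) : ℕ) : ℤ) - (∑ n, z.1.1 (1, n) : ℕ) = x := by
      exact_mod_cast z.1.2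
    have h₂ : (∑ n, z.1.1 (1, n)) - b = k := z.2
    (⟨fun n ↦ z.1.1 (0, n), by simp; omega⟩, ⟨fun n ↦ z.1.1 (1, n), by simp; omega⟩)
  invFun w :=
    have h₁ : ∑ n, w.1.1 n = a + k := (Finset.mem_piAntidiag.1 w.1.2).1
    have h₂ : ∑ n, w.2.1 n = b + k := (Finset.mem_piAntidiag.1 w.2.2).1
    ⟨⟨fun p ↦ if p.1 = 0 then w.1.1 p.2 else w.2.1 p.2, by
      simp only [if_true, one_ne_zero, if_false]
      rw [← Nat.cast_sum, ← Nat.cast_sum]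
      omega⟩, by simp [h₂]⟩
  left_inv z := by
    ext ⟨s, n⟩
    fin_cases s <;> simp
  right_inv w := by
    ext n <;> simp


/-- The confluent hypergeometric limit function ₀F₁(b, z). -/
noncomputable def hyp0F1 (b z : ℝ) : ℝ :=
  ∑' n : ℕ, (Real.Gamma b / Real.Gamma (b + n)) * z ^ n / (n.factorial : ℝ)

/-- The normalization identity for the diffnomial distribution: the sum over all tuples
`z : {0,1} × {1,…,N} → ℕ` with `∑ₙ z₀ₙ − ∑ₙ z₁ₙ = x` of `∏ λ^z/z!` equals
`λ̄₀^{max(x,0)} λ̄₁^{max(−x,0)} ₀F₁(|x|+1, λ̄₀λ̄₁) / Γ(|x|+1)`. -/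
theorem diffnomial_normalization
    (N : ℕ) (hN : 1 ≤ N)
    (lam : Fin 2 × Fin N → ℝ) (hlam : ∀ p, 0 < lam p) (x : ℤ) :
    ∑' z : {z : Fin 2 × Fin N → ℕ //
        (∑ n : Fin N, (z (0, n) : ℤ)) - ∑ n : Fin N, (z (1, n) : ℤ) = x},
      ∏ p : Fin 2 × Fin N, lam p ^ (z.1 p) / ((z.1 p).factorial : ℝ)
    = (∑ n : Fin N, lam (0, n)) ^ (max x 0).toNat
        * (∑ n : Fin N, lam (1, n)) ^ (max (-x) 0).toNat
        * hyp0F1 ((x.natAbs : ℝ) + 1)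
            ((∑ n : Fin N, lam (0, n)) * ∑ n : Fin N, lam (1, n))
        / Real.Gamma ((x.natAbs : ℝ) + 1) := by
  obtain ⟨a, ha⟩ : ∃ a, a = (max x 0).toNat := ⟨_, rfl⟩
  obtain ⟨b, hb⟩ : ∃ b, b = (max (-x) 0).toNat := ⟨_, rfl⟩
  have hx : (a : ℤ) - b = x := by omega
  have hab : a = 0 ∨ b = 0 := by omega
  have habs : x.natAbs = a + b := by omega
  rw [← ha, ← hb, habs, tsum_fiber_of_nonneg
    (fun z ↦ Finset.prod_nonneg fun p _ ↦ div_nonneg (pow_nonneg (hlam p).le _) (by positivity))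
    (fun z ↦ (∑ n, z.1 (1, n)) - b)
    (fun k ↦ have := Finite.of_equiv _ (rowSumFiberEquiv (N := N) hx hab k).symm
      Summable.of_finite)]
  have hGamma (m : ℕ) : Real.Gamma ((m : ℝ) + 1) = (m.factorial : ℝ) :=
    Real.Gamma_nat_eq_factorial m
  rw [hyp0F1, ← tsum_mul_left, ← tsum_div_const]
  refine tsum_congr fun k ↦ ?_
  rw [← (rowSumFiberEquiv (N := N) hx hab k).symm.tsum_eq, tsum_fintype, Fintype.sum_prod_type]
  have hshift : ((a + b : ℕ) : ℝ) + 1 + k = ((a + b + k : ℕ) : ℝ) + 1 := by push_cast; ring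
  have hfact : ((a + k).factorial : ℝ) * (b + k).factorial
      = (a + b + k).factorial * k.factorial := by
    rcases hab with rfl | rfl <;> simp [mul_comm]
  calc _ = ∑ u : Finset.piAntidiag (Finset.univ : Finset (Fin N)) (a + k),
          ∑ v : Finset.piAntidiag (Finset.univ : Finset (Fin N)) (b + k),
            (∏ n, lam (0, n) ^ u.1 n / ((u.1 n).factorial : ℝ))
              * ∏ n, lam (1, n) ^ v.1 n / ((v.1 n).factorial : ℝ) := by
        simp [rowSumFiberEquiv, Fintype.prod_prod_type, div_mul_div_comm]
    _ = (∑ n, lam (0, n)) ^ (a + k) / ((a + k).factorial : ℝ)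
          * ((∑ n, lam (1, n)) ^ (b + k) / ((b + k).factorial : ℝ)) := by
        rw [← Fintype.sum_mul_sum, ← sum_piAntidiag_prod_pow_div_factorial,
          ← sum_piAntidiag_prod_pow_div_factorial,
          Finset.sum_coe_sort (Finset.piAntidiag _ (a + k))
            (fun u ↦ ∏ n, lam (0, n) ^ u n / ((u n).factorial : ℝ)),
          Finset.sum_coe_sort (Finset.piAntidiag _ (b + k))
            (fun v ↦ ∏ n, lam (1, n) ^ v n / ((v n).factorial : ℝ))]
    _ = _ := by
        rw [hshift, hGamma, hGamma, div_mul_div_comm, hfact]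
        field_simp
        ring
end

section
/- For all λ₀, λ₁ > 0 and all x ∈ ℝ, the divergence satisfies 𝒟(x ∣ λ₀, λ₁) ≥ 0, and 𝒟(x ∣ λ₀, λ₁) = 0 if and only if x = λ₀ − λ₁. -/
/-- The divergence 𝒟(x ∣ λ₀, λ₁) generalizing the Kullback–Leibler divergence to signed
data (with the convention `0 · ln 0 = 0`, automatic since `Real.log 0 = 0`). -/
noncomputable def skellamDiv (x l₀ l₁ : ℝ) : ℝ :=
  (l₀ - max x 0 * Real.log l₀) + (l₁ - max (-x) 0 * Real.log l₁)
    - Real.sqrt (x ^ 2 + 4 * l₀ * l₁)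
    + |x| * Real.log ((|x| + Real.sqrt (x ^ 2 + 4 * l₀ * l₁)) / 2)

/-- The divergence in terms of `u = (|x| + √(x² + 4ab)) / 2` and `v = (√(x² + 4ab) - |x|) / 2`. -/
theorem sub_mul_log_nonneg_and_eq_zero_iff {a b u v : ℝ} (ha : 0 < a) (hb : 0 < b) (hu : 0 < u)
    (huv : u * v = a * b) :
    0 ≤ a + b - (u + v) + (u - v) * (Real.log u - Real.log a) ∧
      (a + b - (u + v) + (u - v) * (Real.log u - Real.log a) = 0 ↔ u = a) := by
  have hv : 0 < v := by
    have : 0 < u * v := huv ▸ mul_pos ha hb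
    exact (pos_iff_pos_of_mul_pos this).1 hu
  have hlog : Real.log a - Real.log u ≤ a / u - 1 := by
    rw [← Real.log_div ha.ne' hu.ne']
    exact Real.log_le_sub_one_of_pos (div_pos ha hu)
  have hlog' : Real.log u - Real.log a ≤ u / a - 1 := by
    rw [← Real.log_div hu.ne' ha.ne']
    exact Real.log_le_sub_one_of_pos (div_pos hu ha)
  have h₁ : 0 ≤ a - u + u * (Real.log u - Real.log a) := by
    have := mul_le_mul_of_nonneg_left hlog hu.le
    have e : u * (a / u - 1) = a - u := by field_simp
    linarith
  have hb' : v * (u / a - 1) = b - v := by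
    field_simp
    linarith
  have h₂ : 0 ≤ b - v - v * (Real.log u - Real.log a) := by
    have := mul_le_mul_of_nonneg_left hlog' hv.le
    linarith
  refine ⟨by linarith, fun h => ?_, ?_⟩
  · by_contra hne
    have hlt : Real.log u - Real.log a < u / a - 1 := by
      rw [← Real.log_div hu.ne' ha.ne']
      refine Real.log_lt_sub_one_of_pos (div_pos hu ha) fun h1 => hne ?_
      rwa [div_eq_one_iff_eq ha.ne'] at h1
    have := mul_lt_mul_of_pos_left hlt hv
    linarith
  · rintro rfl
    have : v = b := mul_left_cancel₀ hu.ne' huv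
    simp [this]

theorem skellamDiv_neg (x l₀ l₁ : ℝ) : skellamDiv (-x) l₀ l₁ = skellamDiv x l₁ l₀ := by
  have : x ^ 2 + 4 * l₀ * l₁ = x ^ 2 + 4 * l₁ * l₀ := by ring
  simp only [skellamDiv, neg_neg, abs_neg, neg_sq, this]
  ring

theorem skellamDiv_nonneg_eq_zero_iff_of_nonneg {l₀ l₁ x : ℝ} (hl₀ : 0 < l₀) (hl₁ : 0 < l₁)
    (hx : 0 ≤ x) :
    0 ≤ skellamDiv x l₀ l₁ ∧ (skellamDiv x l₀ l₁ = 0 ↔ x = l₀ - l₁) := by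
  have hpos : 0 < x ^ 2 + 4 * l₀ * l₁ := by positivity
  have hS := Real.sqrt_pos.2 hpos
  have hS2 := Real.sq_sqrt hpos.le
  have hD : skellamDiv x l₀ l₁ = l₀ - x * Real.log l₀ + l₁ - √(x ^ 2 + 4 * l₀ * l₁)
      + x * Real.log ((x + √(x ^ 2 + 4 * l₀ * l₁)) / 2) := by
    rw [skellamDiv, abs_of_nonneg hx, max_eq_left hx, max_eq_right (by linarith)]
    ring
  rw [hD]
  set S := √(x ^ 2 + 4 * l₀ * l₁)
  obtain ⟨h₁, h₂⟩ := sub_mul_log_nonneg_and_eq_zero_iff (u := (x + S) / 2) (v := (S - x) / 2)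
    hl₀ hl₁ (by positivity) (by linear_combination hS2 / 4)
  have e : l₀ + l₁ - ((x + S) / 2 + (S - x) / 2)
      + ((x + S) / 2 - (S - x) / 2) * (Real.log ((x + S) / 2) - Real.log l₀)
      = l₀ - x * Real.log l₀ + l₁ - S + x * Real.log ((x + S) / 2) := by ring
  rw [e] at h₁ h₂
  refine ⟨h₁, h₂.trans ⟨fun h => ?_, fun h => ?_⟩⟩
  · have hSx : S = 2 * l₀ - x := by linarith
    rw [hSx] at hS2
    refine mul_left_cancel₀ hl₀.ne' ?_
    linear_combination -hS2 / 4
  · have : S = l₀ + l₁ := by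
      refine (sq_eq_sq₀ hS.le (by positivity)).1 ?_
      rw [hS2, h]
      ring
    linarith

/-- The divergence 𝒟 is nonnegative, and vanishes iff `x = λ₀ − λ₁`. -/
theorem skellamDiv_nonneg_eq_zero_iff
    (l₀ l₁ : ℝ) (hl₀ : 0 < l₀) (hl₁ : 0 < l₁) (x : ℝ) :
    0 ≤ skellamDiv x l₀ l₁ ∧ (skellamDiv x l₀ l₁ = 0 ↔ x = l₀ - l₁) := by
  rcases le_total 0 x with hx | hx
  · exact skellamDiv_nonneg_eq_zero_iff_of_nonneg hl₀ hl₁ hx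
  · obtain ⟨h₁, h₂⟩ := skellamDiv_nonneg_eq_zero_iff_of_nonneg hl₁ hl₀ (neg_nonneg.2 hx)
    rw [skellamDiv_neg] at h₁ h₂
    refine ⟨h₁, h₂.trans ?_⟩
    rw [neg_eq_iff_eq_neg, neg_sub]
end

section
/- Let λ₀, λ₁ > 0, let x ∈ ℝ, and let (k_M)_{M∈ℕ} be a sequence of integers with k_M/M → x as M → ∞. Then (1/M) · ln p_{Mλ₀, Mλ₁}(k_M) converges, as M → ∞, to −𝒟(x ∣ λ₀, λ₁). -/
open Filter

/-- The pmf of the Skellam distribution `Skell(l₀, l₁)` at `x : ℤ`. -/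
noncomputable def skellamPMF (l₀ l₁ : ℝ) (x : ℤ) : ℝ :=
  ∑' n : ℕ,
    (Real.exp (-l₀) * l₀ ^ (n + (max x 0).toNat) / ((n + (max x 0).toNat).factorial : ℝ))
      * (Real.exp (-l₁) * l₁ ^ (n + (max (-x) 0).toNat)
          / ((n + (max (-x) 0).toNat).factorial : ℝ))

/-- The weight that the Poisson distribution of rate `l` gives to `n`. -/
noncomputable def poissonWeight (l : ℝ) (n : ℕ) : ℝ :=
  Real.exp (-l) * l ^ n / (n.factorial : ℝ)

lemma poissonWeight_pos {l : ℝ} (hl : 0 < l) (n : ℕ) : 0 < poissonWeight l n := by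
  unfold poissonWeight
  positivity

lemma hasSum_poissonWeight (l : ℝ) : HasSum (poissonWeight l) 1 := by
  have h := (NormedSpace.expSeries_div_hasSum_exp l).mul_left (Real.exp (-l))
  rw [← Real.exp_eq_exp_ℝ, ← Real.exp_add, neg_add_cancel, Real.exp_zero] at h
  exact h.congr_fun fun n => by simp only [poissonWeight, mul_div_assoc]

lemma poissonWeight_le_one {l : ℝ} (hl : 0 < l) (n : ℕ) : poissonWeight l n ≤ 1 :=
  le_hasSum (hasSum_poissonWeight l) n fun m _ => (poissonWeight_pos hl m).le

/-- Changing the rate of a Poisson distribution tilts its weights exponentially. -/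
lemma poissonWeight_eq_tilt {l a : ℝ} (ha : a ≠ 0) (n : ℕ) :
    poissonWeight l n = Real.exp (a - l) * (l / a) ^ n * poissonWeight a n := by
  have h : Real.exp (-l) = Real.exp (a - l) * Real.exp (-a) := by
    rw [← Real.exp_add]; congr 1; ring
  unfold poissonWeight
  rw [h, div_pow]
  field_simp

lemma summable_poissonWeight_mul {a b : ℝ} (ha : 0 < a) (hb : 0 < b) (i j : ℕ) :
    Summable fun n => poissonWeight a (n + i) * poissonWeight b (n + j) :=
  Summable.of_nonneg_of_le
    (fun _ => (mul_pos (poissonWeight_pos ha _) (poissonWeight_pos hb _)).le)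
    (fun _ => mul_le_of_le_one_right (poissonWeight_pos ha _).le (poissonWeight_le_one hb _))
    ((summable_nat_add_iff i).2 (hasSum_poissonWeight a).summable)

lemma tsum_poissonWeight_mul_le_one {a b : ℝ} (ha : 0 < a) (hb : 0 < b) (i j : ℕ) :
    ∑' n, poissonWeight a (n + i) * poissonWeight b (n + j) ≤ 1 :=
  calc
    _ ≤ ∑' n, poissonWeight a (n + i) :=
      (summable_poissonWeight_mul ha hb i j).tsum_le_tsum
        (fun _ => mul_le_of_le_one_right (poissonWeight_pos ha _).le (poissonWeight_le_one hb _))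
        ((summable_nat_add_iff i).2 (hasSum_poissonWeight a).summable)
    _ ≤ ∑' n, poissonWeight a n :=
      tsum_comp_le_tsum_of_inj (hasSum_poissonWeight a).summable
        (fun n => (poissonWeight_pos ha n).le) (add_left_injective i)
    _ = 1 := (hasSum_poissonWeight a).tsum_eq

lemma tsum_poissonWeight_mul_eq_tilt {l₀ l₁ a b : ℝ} (ha : a ≠ 0) (hb : b ≠ 0)
    (hab : a * b = l₀ * l₁) (i j : ℕ) :
    ∑' n, poissonWeight l₀ (n + i) * poissonWeight l₁ (n + j) =
      Real.exp (a + b - l₀ - l₁) * (l₀ / a) ^ i * (l₁ / b) ^ j *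
        ∑' n, poissonWeight a (n + i) * poissonWeight b (n + j) := by
  rw [← tsum_mul_left]
  refine tsum_congr fun n => ?_
  have hone : (l₀ / a) ^ n * (l₁ / b) ^ n = 1 := by
    rw [← mul_pow, div_mul_div_comm, ← hab, div_self (mul_ne_zero ha hb), one_pow]
  have hexp : Real.exp (a + b - l₀ - l₁) = Real.exp (a - l₀) * Real.exp (b - l₁) := by
    rw [← Real.exp_add]; congr 1; ring
  rw [poissonWeight_eq_tilt (l := l₀) ha, poissonWeight_eq_tilt (l := l₁) hb, hexp, pow_add, pow_add]
  linear_combination (Real.exp (a - l₀) * Real.exp (b - l₁) * (l₀ / a) ^ i * (l₁ / b) ^ j *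
    poissonWeight a (n + i) * poissonWeight b (n + j)) * hone

lemma tendsto_log_factorial_div_sub_log :
    Tendsto (fun n : ℕ => Real.log n.factorial / n - Real.log n) atTop (nhds (-1)) := by
  have hinv : Tendsto (fun n : ℕ => (n : ℝ)⁻¹) atTop (nhds 0) := tendsto_inv_atTop_nhds_zero_nat
  have hs := ((Stirling.tendsto_stirlingSeq_sqrt_pi.log (by positivity)).mul hinv)
  have hlog : Tendsto (fun n : ℕ => Real.log n / n) atTop (nhds 0) :=
    Real.isLittleO_log_id_atTop.tendsto_div_nhds_zero.comp tendsto_natCast_atTop_atTop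
  have h := ((hs.add ((hinv.const_mul (Real.log 2 / 2)).add (hlog.const_mul (1 / 2)))).sub_const 1)
  simp only [mul_zero, add_zero, zero_sub] at h
  refine h.congr' ?_
  filter_upwards [eventually_ge_atTop 1] with n hn
  have hn' : (n : ℝ) ≠ 0 := by positivity
  rw [Stirling.log_stirlingSeq_formula, Real.log_mul two_ne_zero hn',
    Real.log_div hn' (Real.exp_ne_zero 1), Real.log_exp]
  field_simp
  ring

/-- Poisson weights near the mean are subexponential. -/
lemma tendsto_log_poissonWeight {a : ℝ} (ha : 0 < a) {n : ℕ → ℕ}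
    (hn : Tendsto (fun M : ℕ => (n M : ℝ) / M) atTop (nhds a)) :
    Tendsto (fun M : ℕ => (1 / M : ℝ) * Real.log (poissonWeight (M * a) (n M)))
      atTop (nhds 0) := by
  have hn_top : Tendsto n atTop atTop := by
    rw [← tendsto_natCast_atTop_iff (R := ℝ)]
    refine (hn.pos_mul_atTop ha tendsto_natCast_atTop_atTop).congr' ?_
    filter_upwards [eventually_ge_atTop 1] with M hM
    have : (M : ℝ) ≠ 0 := by positivity
    field_simp
  have h := ((hn.const_mul (Real.log a)).sub_const a).sub
    (hn.mul ((tendsto_log_factorial_div_sub_log.comp hn_top).add (hn.log ha.ne')))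
  have hz : Real.log a * a - a - a * (-1 + Real.log a) = 0 := by ring
  rw [hz] at h
  refine h.congr' ?_
  filter_upwards [eventually_ge_atTop 1, hn_top.eventually_ge_atTop 1] with M hM hnM
  have hM' : (M : ℝ) ≠ 0 := by positivity
  have hn' : (n M : ℝ) ≠ 0 := by positivity
  have hf : ((n M).factorial : ℝ) ≠ 0 := by positivity
  unfold poissonWeight
  rw [Real.log_div (by positivity) hf, Real.log_mul (by positivity) (by positivity),
    Real.log_exp, Real.log_pow, Real.log_mul hM' ha.ne', Real.log_div hn' hM']
  simp only [Function.comp_apply]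
  field_simp
  ring

/-- Poisson difference distributions are subexponential near the mean `a - b`. -/
lemma tendsto_log_tsum_poissonWeight_mul {a b p q : ℝ} (ha : 0 < a) (hb : 0 < b)
    (hpa : p ≤ a) (hpq : a - p = b - q) {i j : ℕ → ℕ}
    (hi : Tendsto (fun M : ℕ => (i M : ℝ) / M) atTop (nhds p))
    (hj : Tendsto (fun M : ℕ => (j M : ℝ) / M) atTop (nhds q)) :
    Tendsto (fun M : ℕ => (1 / M : ℝ) * Real.log
      (∑' n, poissonWeight (M * a) (n + i M) * poissonWeight (M * b) (n + j M)))
      atTop (nhds 0) := by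
  let n : ℕ → ℕ := fun M => ⌊(a - p) * (M : ℝ)⌋₊
  have hn : Tendsto (fun M : ℕ => (n M : ℝ) / M) atTop (nhds (a - p)) :=
    (tendsto_nat_floor_mul_div_atTop (sub_nonneg.2 hpa)).comp tendsto_natCast_atTop_atTop
  have hni : Tendsto (fun M : ℕ => ((n M + i M : ℕ) : ℝ) / M) atTop (nhds a) := by
    simpa [add_div] using hn.add hi
  have hnj : Tendsto (fun M : ℕ => ((n M + j M : ℕ) : ℝ) / M) atTop (nhds b) := by
    simpa [add_div, hpq] using hn.add hj
  have hlow := (tendsto_log_poissonWeight ha hni).add (tendsto_log_poissonWeight hb hnj)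
  rw [add_zero] at hlow
  refine tendsto_of_tendsto_of_tendsto_of_le_of_le' hlow tendsto_const_nhds ?_ ?_
  all_goals
    filter_upwards [eventually_ge_atTop 1] with M hM
    have hMa : 0 < (M : ℝ) * a := by positivity
    have hMb : 0 < (M : ℝ) * b := by positivity
    have hterm (m : ℕ) :
        0 < poissonWeight (M * a) (m + i M) * poissonWeight (M * b) (m + j M) :=
      mul_pos (poissonWeight_pos hMa _) (poissonWeight_pos hMb _)
    have hsum := summable_poissonWeight_mul hMa hMb (i M) (j M)
  · rw [← mul_add, ← Real.log_mul (poissonWeight_pos hMa _).ne' (poissonWeight_pos hMb _).ne']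
    gcongr
    · exact hterm _
    · exact hsum.le_tsum (n M) fun m _ => (hterm m).le
  · exact mul_nonpos_of_nonneg_of_nonpos (by positivity)
      (Real.log_nonpos (tsum_nonneg fun m => (hterm m).le)
        (tsum_poissonWeight_mul_le_one hMa hMb _ _))

lemma tendsto_log_skellamPMF_of_tilt {l₀ l₁ a b x : ℝ} (hl₀ : 0 < l₀) (hl₁ : 0 < l₁)
    (ha : 0 < a) (hb : 0 < b) (hab : a * b = l₀ * l₁) (hx : a - b = x) {k : ℕ → ℤ}
    (hk : Tendsto (fun M : ℕ => (k M : ℝ) / M) atTop (nhds x)) :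
    Tendsto (fun M : ℕ => (1 / M : ℝ) * Real.log (skellamPMF (M * l₀) (M * l₁) (k M))) atTop
      (nhds (a + b - l₀ - l₁ + max x 0 * Real.log (l₀ / a) + max (-x) 0 * Real.log (l₁ / b))) := by
  have hcast (m : ℤ) : (((max m 0).toNat : ℕ) : ℝ) = max (m : ℝ) 0 := by
    have h : (((max m 0).toNat : ℕ) : ℤ) = max m 0 := Int.toNat_of_nonneg (le_max_right _ _)
    exact_mod_cast congrArg (Int.cast : ℤ → ℝ) h
  have hi : Tendsto (fun M : ℕ => (((max (k M) 0).toNat : ℕ) : ℝ) / M) atTop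
      (nhds (max x 0)) := by
    refine (hk.max tendsto_const_nhds).congr fun M => ?_
    rw [hcast, ← max_div_div_right M.cast_nonneg, zero_div]
  have hj : Tendsto (fun M : ℕ => (((max (-k M) 0).toNat : ℕ) : ℝ) / M) atTop
      (nhds (max (-x) 0)) := by
    refine (hk.neg.max tendsto_const_nhds).congr fun M => ?_
    rw [hcast, ← max_div_div_right M.cast_nonneg, zero_div, Int.cast_neg, neg_div]
  have hpa : max x 0 ≤ a := max_le (by linarith) ha.le
  have hpq : a - max x 0 = b - max (-x) 0 := by
    rcases le_total 0 x with h | h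
    · rw [max_eq_left h, max_eq_right (by linarith)]; linarith
    · rw [max_eq_right h, max_eq_left (by linarith)]; linarith
  have h := (((hi.mul_const (Real.log (l₀ / a))).const_add (a + b - l₀ - l₁)).add
    (hj.mul_const (Real.log (l₁ / b)))).add
      (tendsto_log_tsum_poissonWeight_mul ha hb hpa hpq hi hj)
  rw [add_zero] at h
  refine h.congr' ?_
  filter_upwards [eventually_ge_atTop 1] with M hM
  have hM' : 0 < (M : ℝ) := by positivity
  have hMa : 0 < (M : ℝ) * a := by positivity
  have hMb : 0 < (M : ℝ) * b := by positivity
  have hpos : 0 < ∑' n, poissonWeight (M * a) (n + (max (k M) 0).toNat) *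
      poissonWeight (M * b) (n + (max (-k M) 0).toNat) :=
    (summable_poissonWeight_mul hMa hMb _ _).tsum_pos
      (fun m => (mul_pos (poissonWeight_pos hMa _) (poissonWeight_pos hMb _)).le) 0
      (mul_pos (poissonWeight_pos hMa _) (poissonWeight_pos hMb _))
  have htilt : skellamPMF (M * l₀) (M * l₁) (k M) = _ :=
    tsum_poissonWeight_mul_eq_tilt (l₀ := M * l₀) (l₁ := M * l₁) hMa.ne' hMb.ne'
      (by linear_combination (M : ℝ) ^ 2 * hab) (max (k M) 0).toNat (max (-k M) 0).toNat
  rw [htilt, mul_div_mul_left _ _ hM'.ne', mul_div_mul_left _ _ hM'.ne',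
    Real.log_mul (by positivity) hpos.ne', Real.log_mul (by positivity) (by positivity),
    Real.log_mul (by positivity) (by positivity), Real.log_exp, Real.log_pow, Real.log_pow]
  field_simp

/-- If `k_M / M → x`, then `(1/M)·ln p_{Mλ₀, Mλ₁}(k_M) → −𝒟(x ∣ λ₀, λ₁)`. -/
theorem skellam_log_pmf_limit
    (l₀ l₁ : ℝ) (hl₀ : 0 < l₀) (hl₁ : 0 < l₁) (x : ℝ) (k : ℕ → ℤ)
    (hk : Tendsto (fun M : ℕ => (k M : ℝ) / M) atTop (nhds x)) :
    Tendsto (fun M : ℕ => (1 / M : ℝ) * Real.log (skellamPMF (M * l₀) (M * l₁) (k M)))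
      atTop (nhds (-(skellamDiv x l₀ l₁))) := by
  set s := Real.sqrt (x ^ 2 + 4 * l₀ * l₁) with hs
  have hl : 0 < l₀ * l₁ := mul_pos hl₀ hl₁
  have hsq : s ^ 2 = x ^ 2 + 4 * l₀ * l₁ := Real.sq_sqrt (by nlinarith [sq_nonneg x])
  have hlt : |x| < s := Real.lt_sqrt_of_sq_lt (by rw [sq_abs]; linarith)
  obtain ⟨hx₁, hx₂⟩ := abs_lt.1 hlt
  have ha : 0 < (s + x) / 2 := by linarith
  have hb : 0 < (s - x) / 2 := by linarith
  convert tendsto_log_skellamPMF_of_tilt hl₀ hl₁ ha hb (by linear_combination hsq / 4)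
    (by ring) hk using 2
  rw [Real.log_div hl₀.ne' ha.ne', Real.log_div hl₁.ne' hb.ne', skellamDiv, ← hs]
  rcases le_total 0 x with h | h
  · rw [max_eq_left h, max_eq_right (neg_nonpos.2 h), abs_of_nonneg h, add_comm x s]
    ring
  · rw [max_eq_right h, max_eq_left (neg_nonneg.2 h), abs_of_nonpos h, neg_add_eq_sub]
    ring
end

section
/- Let a ≥ 0, z > 0, and let (b_M)_{M∈ℕ} be a sequence of natural numbers with b_M/M → a as M → ∞. Then (1/M) · ln ₀F₁(b_M + 1, M²z) converges, as M → ∞, to √(a² + 4z) − a + a·ln(2a/(a + √(a² + 4z))), where the last term is read as 0 when a = 0. -/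
open Filter

/-- The elementary Stirling lower bound. -/
lemma mul_log_sub_le_log_factorial (k : ℕ) :
    (k : ℝ) * Real.log k - k ≤ Real.log (k.factorial : ℝ) := by
  rcases Nat.eq_zero_or_pos k with rfl | hk
  · simp
  have hk' : (0 : ℝ) < k := by exact_mod_cast hk
  have h := Real.pow_div_factorial_le_exp (k : ℝ) hk'.le k
  have h2 := Real.log_le_log (by positivity) h
  rw [Real.log_exp, Real.log_div (by positivity) (by positivity), Real.log_pow] at h2
  linarith

/-- An elementary Stirling upper bound. -/
lemma log_factorial_le_succ_mul_log_sub (k : ℕ) :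
    Real.log (k.factorial : ℝ) ≤ ((k : ℝ) + 1) * Real.log ((k : ℝ) + 1) - k := by
  induction k with
  | zero => simp
  | succ k ih =>
    have h1 : (0 : ℝ) < (k : ℝ) + 1 := by positivity
    have h2 : (0 : ℝ) < (k : ℝ) + 1 + 1 := by positivity
    have h := Real.log_le_sub_one_of_pos (div_pos h1 h2)
    rw [Real.log_div h1.ne' h2.ne'] at h
    have h3 := mul_le_mul_of_nonneg_left h h2.le
    have h4 : ((k : ℝ) + 1 + 1) * (((k : ℝ) + 1) / ((k : ℝ) + 1 + 1) - 1) = -1 := by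
      field_simp
      ring
    rw [Nat.factorial_succ]
    push_cast
    rw [Real.log_mul h1.ne' (by positivity)]
    nlinarith

/-- Stirling asymptotics at linear scale: if `k M / M → κ`, then
`(log (k M)! - k M * log M) / M → κ * log κ - κ`. -/
lemma tendsto_log_factorial_sub_div {k : ℕ → ℕ} {κ : ℝ}
    (hk : Tendsto (fun M : ℕ => (k M : ℝ) / M) atTop (nhds κ)) :
    Tendsto (fun M : ℕ => (Real.log ((k M).factorial : ℝ) - k M * Real.log M) / M) atTop
      (nhds (κ * Real.log κ - κ)) := by
  have hinv : Tendsto (fun M : ℕ => (1 : ℝ) / M) atTop (nhds 0) :=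
    tendsto_one_div_atTop_nhds_zero_nat
  have hlog : Tendsto (fun M : ℕ => Real.log M / M) atTop (nhds 0) :=
    (Real.isLittleO_log_id_atTop.tendsto_div_nhds_zero).comp tendsto_natCast_atTop_atTop
  have hk1 : Tendsto (fun M : ℕ => ((k M : ℝ) + 1) / M) atTop (nhds κ) := by
    simpa [add_div] using hk.add hinv
  have hlow := ((Real.continuous_mul_log.tendsto κ).comp hk).sub hk
  have hup := (((Real.continuous_mul_log.tendsto κ).comp hk1).add hlog).sub hk
  rw [add_zero] at hup
  refine tendsto_of_tendsto_of_tendsto_of_le_of_le' hlow hup ?_ ?_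
  · filter_upwards [eventually_gt_atTop 0] with M hM
    have hM' : (0 : ℝ) < M := by exact_mod_cast hM
    have h := mul_log_sub_le_log_factorial (k M)
    simp only [Function.comp_apply]
    rcases Nat.eq_zero_or_pos (k M) with h0 | h0
    · simp [h0]
    · have h0' : (0 : ℝ) < k M := by exact_mod_cast h0
      rw [Real.log_div h0'.ne' hM'.ne', le_div_iff₀ hM']
      field_simp
      linarith
  · filter_upwards [eventually_gt_atTop 0] with M hM
    have hM' : (0 : ℝ) < M := by exact_mod_cast hM
    have h := log_factorial_le_succ_mul_log_sub (k M)
    have h1 : (0 : ℝ) < (k M : ℝ) + 1 := by positivity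
    simp only [Function.comp_apply]
    rw [Real.log_div h1.ne' hM'.ne', div_le_iff₀ hM']
    field_simp
    linarith

lemma hyp0F1_natCast_add_one (b : ℕ) (w : ℝ) :
    hyp0F1 ((b : ℝ) + 1) w =
      ∑' n : ℕ, ((b.factorial : ℝ) / ((b + n).factorial : ℝ)) * w ^ n / (n.factorial : ℝ) := by
  unfold hyp0F1
  refine tsum_congr fun n => ?_
  have h : (b : ℝ) + 1 + n = ((b + n : ℕ) : ℝ) + 1 := by push_cast; ring
  rw [h, Real.Gamma_nat_eq_factorial, Real.Gamma_nat_eq_factorial]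

/-- Each term is dominated through `1 / (b + n)! ≤ exp y / y ^ (b + n)`. -/
lemma hyp0F1_term_le (b n : ℕ) {w y : ℝ} (hw : 0 ≤ w) (hy : 0 < y) :
    ((b.factorial : ℝ) / ((b + n).factorial : ℝ)) * w ^ n / (n.factorial : ℝ) ≤
      (b.factorial * Real.exp y / y ^ b) * ((w / y) ^ n / (n.factorial : ℝ)) := by
  have h := Real.pow_div_factorial_le_exp y hy.le (b + n)
  have h1 : 1 / ((b + n).factorial : ℝ) ≤ Real.exp y / y ^ (b + n) := by
    rw [le_div_iff₀ (by positivity)]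
    calc _ = y ^ (b + n) / ((b + n).factorial : ℝ) := by ring
      _ ≤ _ := h
  calc _ = (b.factorial * w ^ n / (n.factorial : ℝ)) * (1 / ((b + n).factorial : ℝ)) := by ring
    _ ≤ (b.factorial * w ^ n / (n.factorial : ℝ)) * (Real.exp y / y ^ (b + n)) := by gcongr
    _ = _ := by rw [pow_add, div_pow]; field_simp

lemma summable_hyp0F1_term (b : ℕ) {w : ℝ} (hw : 0 ≤ w) :
    Summable fun n : ℕ =>
      ((b.factorial : ℝ) / ((b + n).factorial : ℝ)) * w ^ n / (n.factorial : ℝ) :=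
  Summable.of_nonneg_of_le (fun n => by positivity)
    (fun n => hyp0F1_term_le b n hw one_pos)
    ((Real.summable_pow_div_factorial (w / 1)).mul_left _)

lemma hyp0F1_le (b : ℕ) {w y : ℝ} (hw : 0 ≤ w) (hy : 0 < y) :
    hyp0F1 ((b : ℝ) + 1) w ≤ (b.factorial * Real.exp y / y ^ b) * Real.exp (w / y) := by
  rw [hyp0F1_natCast_add_one, Real.exp_eq_exp_ℝ, NormedSpace.exp_eq_tsum_div,
    ← tsum_mul_left]
  refine (summable_hyp0F1_term b hw).tsum_le_tsum (fun n => ?_)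
    ((Real.summable_pow_div_factorial (w / y)).mul_left _)
  simpa [Real.exp_eq_exp_ℝ, NormedSpace.exp_eq_tsum_div] using hyp0F1_term_le b n hw hy

lemma le_hyp0F1 (b n : ℕ) {w : ℝ} (hw : 0 ≤ w) :
    ((b.factorial : ℝ) / ((b + n).factorial : ℝ)) * w ^ n / (n.factorial : ℝ) ≤
      hyp0F1 ((b : ℝ) + 1) w := by
  rw [hyp0F1_natCast_add_one]
  exact (summable_hyp0F1_term b hw).le_tsum n fun m _ => by positivity

/-- The asymptotics, parametrized by the positive root `x` of `x * (a + x) = z`. -/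
lemma tendsto_log_hyp0F1_div {a x : ℝ} (hx : 0 < x) (hc : 0 < a + x) {b : ℕ → ℕ}
    (hb : Tendsto (fun M : ℕ => (b M : ℝ) / M) atTop (nhds a)) :
    Tendsto
      (fun M : ℕ => Real.log (hyp0F1 ((b M : ℝ) + 1) ((M : ℝ) ^ 2 * (x * (a + x)))) / M)
      atTop (nhds (2 * x + a * Real.log a - a * Real.log (a + x))) := by
  have hn : Tendsto (fun M : ℕ => (⌊x * (M : ℝ)⌋₊ : ℝ) / M) atTop (nhds x) :=
    (tendsto_nat_floor_mul_div_atTop hx.le).comp tendsto_natCast_atTop_atTop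
  have hbn : Tendsto (fun M : ℕ => ((b M + ⌊x * (M : ℝ)⌋₊ : ℕ) : ℝ) / M) atTop
      (nhds (a + x)) := by
    simpa [add_div] using hb.add hn
  have hSb := tendsto_log_factorial_sub_div hb
  have hlow := ((hSb.sub (tendsto_log_factorial_sub_div hbn)).sub
    (tendsto_log_factorial_sub_div hn)).add (hn.mul_const (Real.log (x * (a + x))))
  have hup := (hSb.add_const (a + 2 * x)).sub (hb.mul_const (Real.log (a + x)))
  have elow : a * Real.log a - a - ((a + x) * Real.log (a + x) - (a + x))
      - (x * Real.log x - x) + x * Real.log (x * (a + x))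
      = 2 * x + a * Real.log a - a * Real.log (a + x) := by
    rw [Real.log_mul hx.ne' hc.ne']
    ring
  have eup : a * Real.log a - a + (a + 2 * x) - a * Real.log (a + x)
      = 2 * x + a * Real.log a - a * Real.log (a + x) := by ring
  rw [elow] at hlow
  rw [eup] at hup
  refine tendsto_of_tendsto_of_tendsto_of_le_of_le' hlow hup ?_ ?_
  · filter_upwards [eventually_gt_atTop 0] with M hM
    have hM' : (0 : ℝ) < M := by exact_mod_cast hM
    have h := Real.log_le_log (by positivity)
      (le_hyp0F1 (b M) ⌊x * (M : ℝ)⌋₊ (w := (M : ℝ) ^ 2 * (x * (a + x))) (by positivity))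
    rw [Real.log_div (by positivity) (by positivity), Real.log_mul (by positivity) (by positivity),
      Real.log_div (by positivity) (by positivity), Real.log_pow,
      Real.log_mul (x := (M : ℝ) ^ 2) (by positivity) (by positivity), Real.log_pow] at h
    rw [le_div_iff₀ hM']
    generalize Real.log (hyp0F1 ((b M : ℝ) + 1) ((M : ℝ) ^ 2 * (x * (a + x)))) = L at h ⊢
    generalize ⌊x * (M : ℝ)⌋₊ = n at h ⊢
    push_cast at h ⊢
    field_simp
    linarith
  · filter_upwards [eventually_gt_atTop 0] with M hM
    have hM' : (0 : ℝ) < M := by exact_mod_cast hM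
    have hw : 0 ≤ (M : ℝ) ^ 2 * (x * (a + x)) := by positivity
    have hpos : 0 < hyp0F1 ((b M : ℝ) + 1) ((M : ℝ) ^ 2 * (x * (a + x))) :=
      lt_of_lt_of_le (by positivity) (le_hyp0F1 (b M) 0 hw)
    have h := Real.log_le_log hpos
      (hyp0F1_le (b M) (y := M * (a + x)) hw (by positivity))
    have hq : (M : ℝ) ^ 2 * (x * (a + x)) / (M * (a + x)) = M * x := by field_simp
    rw [hq, Real.log_mul (by positivity) (by positivity),
      Real.log_div (by positivity) (by positivity),
      Real.log_mul (x := ((b M).factorial : ℝ)) (by positivity) (by positivity), Real.log_pow,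
      Real.log_mul (x := (M : ℝ)) (by positivity) (by positivity),
      Real.log_exp, Real.log_exp] at h
    rw [div_le_iff₀ hM']
    generalize Real.log (hyp0F1 ((b M : ℝ) + 1) ((M : ℝ) ^ 2 * (x * (a + x)))) = L at h ⊢
    field_simp
    linarith

/-- If `b_M / M → a` for `a ≥ 0` and `z > 0`, then
`(1/M)·ln ₀F₁(b_M + 1, M²z) → √(a² + 4z) − a + a·ln(2a/(a + √(a² + 4z)))`,
where the last term is read as `0` when `a = 0` (automatic since `Real.log 0 = 0`). -/
theorem hyp0F1_log_asymptotics
    (a : ℝ) (ha : 0 ≤ a) (z : ℝ) (hz : 0 < z) (b : ℕ → ℕ)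
    (hb : Tendsto (fun M : ℕ => (b M : ℝ) / M) atTop (nhds a)) :
    Tendsto
      (fun M : ℕ => (1 / M : ℝ) * Real.log (hyp0F1 ((b M : ℝ) + 1) ((M : ℝ) ^ 2 * z)))
      atTop
      (nhds (Real.sqrt (a ^ 2 + 4 * z) - a
        + a * Real.log (2 * a / (a + Real.sqrt (a ^ 2 + 4 * z))))) := by
  set s := Real.sqrt (a ^ 2 + 4 * z)
  have hsq : s ^ 2 = a ^ 2 + 4 * z := Real.sq_sqrt (by positivity)
  have has : a < s := Real.lt_sqrt_of_sq_lt (by linarith)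
  have hx : 0 < (s - a) / 2 := by linarith
  have hc : 0 < a + (s - a) / 2 := by linarith
  have hxz : (s - a) / 2 * (a + (s - a) / 2) = z := by linear_combination hsq / 4
  have h := tendsto_log_hyp0F1_div hx hc hb
  rw [hxz] at h
  have hlim : 2 * ((s - a) / 2) + a * Real.log a - a * Real.log (a + (s - a) / 2)
      = s - a + a * Real.log (2 * a / (a + s)) := by
    rcases ha.eq_or_lt with rfl | ha'
    · simp
      ring
    · have e : 2 * a / (a + s) = a / (a + (s - a) / 2) := by
        rw [show a + (s - a) / 2 = (a + s) / 2 by ring]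
        field_simp
      rw [e, Real.log_div ha'.ne' hc.ne']
      ring
  rw [hlim] at h
  refine h.congr fun M => ?_
  ring
end

section
/- Let a ≥ 0, c > 0, and let (b_M)_{M∈ℕ} be a sequence of natural numbers with b_M/M → a as M → ∞. Then the ratio of modified Bessel functions I_{b_M+1}(cM)/I_{b_M}(cM) converges, as M → ∞, to (√(a² + c²) − a)/c. -/
open Filter

/-- The modified Bessel function of the first kind of integer order `p ≥ 0`. -/
noncomputable def besselI (p : ℕ) (z : ℝ) : ℝ :=
  ∑' m : ℕ, (z / 2) ^ (2 * m + p) / ((m.factorial : ℝ) * Real.Gamma ((m : ℝ) + p + 1))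

/-- The `m`-th term of the power series of `I_p(z)`, with a factorial in place of `Γ`. -/
noncomputable def besselITerm (p : ℕ) (z : ℝ) (m : ℕ) : ℝ :=
  (z / 2) ^ (2 * m + p) / ((m.factorial : ℝ) * ((m + p).factorial : ℝ))

theorem besselI_eq_tsum (p : ℕ) (z : ℝ) : besselI p z = ∑' m, besselITerm p z m := by
  unfold besselI besselITerm
  congr 1
  ext m
  rw [← Real.Gamma_nat_eq_factorial (m + p)]
  push_cast
  rfl

theorem besselITerm_nonneg (p : ℕ) {z : ℝ} (hz : 0 ≤ z) (m : ℕ) : 0 ≤ besselITerm p z m := by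
  unfold besselITerm
  positivity

theorem summable_besselITerm (p : ℕ) {z : ℝ} (hz : 0 ≤ z) : Summable (besselITerm p z) := by
  refine Summable.of_nonneg_of_le (besselITerm_nonneg p hz) (fun m => ?_)
    ((Real.summable_pow_div_factorial ((z / 2) ^ 2)).mul_left ((z / 2) ^ p))
  unfold besselITerm
  rw [pow_add, pow_mul, mul_comm, ← mul_div_assoc]
  have h : (1 : ℝ) ≤ ((m + p).factorial : ℝ) := by
    exact_mod_cast Nat.one_le_iff_ne_zero.mpr (Nat.factorial_ne_zero _)
  gcongr
  exact le_mul_of_one_le_right (by positivity) h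

theorem besselI_pos (p : ℕ) {z : ℝ} (hz : 0 < z) : 0 < besselI p z := by
  rw [besselI_eq_tsum]
  refine (summable_besselITerm p hz.le).tsum_pos (besselITerm_nonneg p hz.le) 0 ?_
  unfold besselITerm
  positivity

/-- The three-term recurrence `I_p(z) = (2(p+1)/z) I_{p+1}(z) + I_{p+2}(z)`. -/
theorem besselI_recurrence (p : ℕ) {z : ℝ} (hz : 0 < z) :
    besselI p z = 2 * ((p + 1) / z) * besselI (p + 1) z + besselI (p + 2) z := by
  have hs := (summable_besselITerm (p + 1) hz.le).mul_left (2 * (((p : ℝ) + 1) / z))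
  rw [besselI_eq_tsum, besselI_eq_tsum, besselI_eq_tsum, ← tsum_mul_left,
    (summable_besselITerm p hz.le).tsum_eq_zero_add, hs.tsum_eq_zero_add, add_assoc,
    ← ((summable_nat_add_iff 1).mpr hs).tsum_add (summable_besselITerm (p + 2) hz.le)]
  congr 1
  · simp only [besselITerm, mul_zero, zero_add, Nat.factorial_succ, Nat.factorial_zero, pow_succ]
    push_cast
    field_simp
  · congr 1
    ext m
    have e₁ : m + 1 + p = m + p + 1 := by ring
    have e₂ : m + 1 + (p + 1) = m + p + 1 + 1 := by ring
    have e₃ : m + (p + 2) = m + p + 1 + 1 := by ring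
    have e₄ : 2 * (m + 1) + p = 2 * m + p + 2 := by ring
    have e₅ : 2 * (m + 1) + (p + 1) = 2 * m + p + 3 := by ring
    have e₆ : 2 * m + (p + 2) = 2 * m + p + 2 := by ring
    simp only [besselITerm, e₁, e₂, e₃, e₄, e₅, e₆, Nat.factorial_succ, pow_add]
    push_cast
    field_simp
    ring

theorem sum_antidiagonal_besselITerm (p q : ℕ) (z : ℝ) (k : ℕ) :
    ∑ ij ∈ Finset.HasAntidiagonal.antidiagonal k, besselITerm p z ij.1 * besselITerm q z ij.2 =
      (z / 2) ^ (2 * k + p + q) * ((2 * k + p + q).choose k : ℝ) /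
        (((k + p).factorial : ℝ) * ((k + q).factorial : ℝ)) := by
  have e : 2 * k + p + q = (k + q) + (k + p) := by ring
  have hc : ((2 * k + p + q).choose k : ℝ) = ∑ ij ∈ Finset.HasAntidiagonal.antidiagonal k,
      ((k + q).choose ij.1 : ℝ) * ((k + p).choose ij.2 : ℝ) := by
    rw [e, Nat.add_choose_eq]
    push_cast
    rfl
  rw [hc, Finset.mul_sum, Finset.sum_div]
  refine Finset.sum_congr rfl fun ij hij => ?_
  obtain ⟨i, j⟩ := ij
  obtain rfl : i + j = k := by simpa using hij
  have h₁ : i + j + q = i + (j + q) := by ring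
  have h₂ : i + j + p = j + (i + p) := by ring
  simp only
  rw [h₁, h₂, Nat.cast_add_choose, Nat.cast_add_choose]
  have h₃ : 2 * (i + j) + p + q = (2 * i + p) + (2 * j + q) := by ring
  rw [h₃, pow_add (z / 2) (2 * i + p)]
  unfold besselITerm
  field_simp

/-- Cauchy product of two Bessel series. -/
theorem hasSum_besselI_mul (p q : ℕ) {z : ℝ} (hz : 0 ≤ z) :
    HasSum (fun k : ℕ => (z / 2) ^ (2 * k + p + q) * ((2 * k + p + q).choose k : ℝ) /
        (((k + p).factorial : ℝ) * ((k + q).factorial : ℝ))) (besselI p z * besselI q z) := by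
  have hp := summable_besselITerm p hz
  have hq := summable_besselITerm q hz
  have hpq := hp.mul_of_nonneg hq (besselITerm_nonneg p hz) (besselITerm_nonneg q hz)
  simp only [← sum_antidiagonal_besselITerm]
  rw [besselI_eq_tsum, besselI_eq_tsum, hp.tsum_mul_tsum_eq_tsum_sum_antidiagonal hq hpq]
  exact (summable_sum_mul_antidiagonal_of_summable_mul hpq).hasSum

/-- Turán's inequality for `I_p`. -/
theorem besselI_mul_le_sq (p : ℕ) {z : ℝ} (hz : 0 ≤ z) :
    besselI p z * besselI (p + 2) z ≤ besselI (p + 1) z ^ 2 := by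
  rw [sq]
  refine hasSum_le (fun k => ?_) (hasSum_besselI_mul p (p + 2) hz)
    (hasSum_besselI_mul (p + 1) (p + 1) hz)
  have e : 2 * k + (p + 1) + (p + 1) = 2 * k + p + (p + 2) := by ring
  rw [e]
  refine div_le_div_of_nonneg_left (by positivity) (by positivity) ?_
  rw [← add_assoc, ← add_assoc, Nat.factorial_succ (k + p + 1), Nat.factorial_succ (k + p)]
  push_cast
  have h : (0 : ℝ) ≤ ((k + p).factorial : ℝ) ^ 2 * (k + p + 1) := by positivity
  nlinarith

theorem besselI_ratio_lower (p : ℕ) {z : ℝ} (hz : 0 < z) :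
    Real.sqrt (((p + 1) / z) ^ 2 + 1) - (p + 1) / z ≤ besselI (p + 1) z / besselI p z := by
  have h₀ := besselI_pos p hz
  have h₁ := besselI_pos (p + 1) hz
  have hr := besselI_recurrence p hz
  have ht := besselI_mul_le_sq p hz.le
  set α : ℝ := (p + 1) / z
  have hα : 0 < α := by positivity
  clear_value α
  rw [sub_le_iff_le_add]
  refine Real.sqrt_le_iff.mpr ⟨by positivity, ?_⟩
  rw [div_add' _ _ _ h₀.ne', div_pow, le_div_iff₀ (by positivity)]
  linear_combination besselI p z * hr + ht

theorem besselI_ratio_upper (p : ℕ) {z : ℝ} (hz : 0 < z) :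
    besselI (p + 1) z / besselI p z ≤
      (2 * ((p + 1) / z) + (Real.sqrt (((p + 2) / z) ^ 2 + 1) - (p + 2) / z))⁻¹ := by
  have h₀ := besselI_pos p hz
  have h₁ := besselI_pos (p + 1) hz
  have hl := besselI_ratio_lower (p + 1) hz
  have e : ((p + 1 : ℕ) : ℝ) + 1 = p + 2 := by push_cast; ring
  rw [e] at hl
  have hpos : 0 < Real.sqrt ((((p : ℝ) + 2) / z) ^ 2 + 1) - (p + 2) / z :=
    sub_pos.mpr (Real.lt_sqrt_of_sq_lt (lt_add_one _))
  rw [← inv_div]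
  refine inv_anti₀ (by positivity) ?_
  rw [besselI_recurrence p hz, add_div _ (besselI (p + 2) z), mul_div_cancel_right₀ _ h₁.ne']
  gcongr

/-- If `b_M / M → a` for `a ≥ 0` and `c > 0`, then the Bessel ratio
`I_{b_M + 1}(cM) / I_{b_M}(cM)` converges to `(√(a² + c²) − a)/c`. -/
theorem bessel_ratio_limit
    (a : ℝ) (ha : 0 ≤ a) (c : ℝ) (hc : 0 < c) (b : ℕ → ℕ)
    (hb : Tendsto (fun M : ℕ => (b M : ℝ) / M) atTop (nhds a)) :
    Tendsto (fun M : ℕ => besselI (b M + 1) (c * M) / besselI (b M) (c * M))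
      atTop (nhds ((Real.sqrt (a ^ 2 + c ^ 2) - a) / c)) := by
  have hα (k : ℝ) : Tendsto (fun M : ℕ => ((b M : ℝ) + k) / (c * M)) atTop (nhds (a / c)) := by
    have h := (hb.add (tendsto_const_div_atTop_nhds_zero_nat k)).div_const c
    rw [add_zero] at h
    refine h.congr fun M => ?_
    rw [← add_div, div_div, mul_comm]
  have hg (k : ℝ) := (((hα k).pow 2).add_const 1).sqrt.sub (hα k)
  have hlim : Real.sqrt ((a / c) ^ 2 + 1) - a / c = (Real.sqrt (a ^ 2 + c ^ 2) - a) / c := by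
    have e : (a / c) ^ 2 + 1 = (a ^ 2 + c ^ 2) / c ^ 2 := by field_simp
    rw [e, Real.sqrt_div (by positivity), Real.sqrt_sq hc.le, sub_div]
  have hβ : 0 ≤ a / c := by positivity
  have hden : 0 < 2 * (a / c) + (Real.sqrt ((a / c) ^ 2 + 1) - a / c) := by
    have : 0 < Real.sqrt ((a / c) ^ 2 + 1) := by positivity
    linarith
  have hinv : (2 * (a / c) + (Real.sqrt ((a / c) ^ 2 + 1) - a / c))⁻¹ =
      Real.sqrt ((a / c) ^ 2 + 1) - a / c := by
    refine inv_eq_of_mul_eq_one_right ?_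
    have hs := Real.sq_sqrt (show 0 ≤ (a / c) ^ 2 + 1 by positivity)
    linear_combination hs
  have hu := (((hα 1).const_mul 2).add (hg 2)).inv₀ hden.ne'
  rw [hinv] at hu
  rw [← hlim]
  refine tendsto_of_tendsto_of_tendsto_of_le_of_le' (hg 1) hu ?_ ?_ <;>
    filter_upwards [eventually_gt_atTop 0] with M hM
  · exact besselI_ratio_lower (b M) (by positivity)
  · exact besselI_ratio_upper (b M) (by positivity)
end

section
/- Let K, A, B be nonempty finite sets and let υ : K → A and ω : K → B be surjective maps. Let γ : A → ℝ and δ : B → (0,∞) be given. For α : A → (0,∞) and β : B → (0,∞), define G(α, β) = ∑_{κ∈K} ( α(υ(κ))·ln β(ω(κ)) − ln Γ(α(υ(κ))) ) + ∑_{a∈A} γ(a)·α(a) − ∑_{b∈B} δ(b)·β(b). Suppose α : A → (0,∞) and β : B → (0,∞) are given, α' : A → (0,∞) satisfies, for every a ∈ A, ψ(α'(a)) = ( ∑_{κ∈υ⁻¹(a)} ln β(ω(κ)) + γ(a) ) / |υ⁻¹(a)|, and β' : B → (0,∞) is defined by β'(b) = ( ∑_{κ∈ω⁻¹(b)} α'(υ(κ))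 ) / δ(b). Then G(α', β') ≥ G(α, β). (Proposition 1: the gamma-prior hyperparameter updates make the normalized ELBO non-decreasing.) -/
/-- The digamma function `ψ`, the derivative of `x ↦ ln Γ(x)`. -/
noncomputable def digamma (x : ℝ) : ℝ := deriv (fun y : ℝ => Real.log (Real.Gamma y)) x

/-- The tangent line of `ln Γ` at `x > 0` lies below its graph on `(0, ∞)`. -/
theorem log_Gamma_add_digamma_mul_le {x y : ℝ} (hx : 0 < x) (hy : 0 < y) :
    Real.log (Real.Gamma x) + digamma x * (y - x) ≤ Real.log (Real.Gamma y) := by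
  have hc : ConvexOn ℝ (Set.Ioi 0) (fun y : ℝ => Real.log (Real.Gamma y)) :=
    Real.convexOn_log_Gamma
  have hd : DifferentiableAt ℝ (fun y : ℝ => Real.log (Real.Gamma y)) x := by
    refine (Real.differentiableAt_Gamma fun m => ?_).log (Real.Gamma_pos_of_pos hx).ne'
    have : (0 : ℝ) ≤ m := m.cast_nonneg
    linarith
  rcases lt_trichotomy x y with h | rfl | h
  · have hs := hc.deriv_le_slope hx hy h hd
    rw [slope_def_field, le_div_iff₀ (sub_pos.mpr h)] at hs
    unfold digamma
    linarith
  · simp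
  · have hs := hc.slope_le_deriv hy hx h hd
    rw [slope_def_field, div_le_iff₀ (sub_pos.mpr h)] at hs
    unfold digamma
    linarith

/-- For `s = d * t`, the function `y ↦ s * ln y - d * y` on `(0, ∞)` is maximal at `t`. -/
theorem mul_log_sub_mul_le {d t y : ℝ} (hd : 0 < d) (ht : 0 < t) (hy : 0 < y) :
    d * t * Real.log y - d * y ≤ d * t * Real.log t - d * t := by
  have h := Real.log_le_sub_one_of_pos (div_pos hy ht)
  rw [Real.log_div hy.ne' ht.ne'] at h
  have h2 := mul_le_mul_of_nonneg_left h (mul_pos hd ht).le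
  have h3 : d * t * (y / t - 1) = d * y - d * t := by field_simp
  linarith

/-- Proposition 1: the gamma-prior hyperparameter updates make the normalized ELBO
`G(α, β) = ∑_κ (α(υ(κ))·ln β(ω(κ)) − ln Γ(α(υ(κ)))) + ∑_a γ(a)·α(a) − ∑_b δ(b)·β(b)`
non-decreasing. -/
theorem gamma_hyperparameter_update_nondecreasing
    {K A B : Type*} [Fintype K] [Fintype A] [Fintype B]
    [Nonempty K] [Nonempty A] [Nonempty B] [DecidableEq A] [DecidableEq B]
    (υ : K → A) (ω : K → B)
    (hυ : Function.Surjective υ) (hω : Function.Surjective ω)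
    (γ : A → ℝ) (δ : B → ℝ) (hδ : ∀ b, 0 < δ b)
    (α : A → ℝ) (hα : ∀ a, 0 < α a) (β : B → ℝ) (hβ : ∀ b, 0 < β b)
    (α' : A → ℝ) (hα' : ∀ a, 0 < α' a)
    (hupdα : ∀ a, digamma (α' a)
      = ((∑ κ ∈ Finset.univ.filter (fun κ => υ κ = a), Real.log (β (ω κ))) + γ a)
          / ((Finset.univ.filter (fun κ => υ κ = a)).card : ℝ))
    (β' : B → ℝ)
    (hβ' : ∀ b, β' b
      = (∑ κ ∈ Finset.univ.filter (fun κ => ω κ = b), α' (υ κ)) / δ b) :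
    (∑ κ : K, (α (υ κ) * Real.log (β (ω κ)) - Real.log (Real.Gamma (α (υ κ)))))
        + ∑ a : A, γ a * α a - ∑ b : B, δ b * β b
      ≤ (∑ κ : K, (α' (υ κ) * Real.log (β' (ω κ)) - Real.log (Real.Gamma (α' (υ κ)))))
        + ∑ a : A, γ a * α' a - ∑ b : B, δ b * β' b := by
  have hstepα : (∑ κ : K, (α (υ κ) * Real.log (β (ω κ)) - Real.log (Real.Gamma (α (υ κ)))))
        + ∑ a : A, γ a * α a
      ≤ (∑ κ : K, (α' (υ κ) * Real.log (β (ω κ)) - Real.log (Real.Gamma (α' (υ κ)))))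
        + ∑ a : A, γ a * α' a := by
    have fiber (x : A → ℝ) :
        (∑ κ : K, (x (υ κ) * Real.log (β (ω κ)) - Real.log (Real.Gamma (x (υ κ)))))
          + ∑ a : A, γ a * x a
        = ∑ a : A, ((Finset.univ.filter (fun κ => υ κ = a)).card : ℝ)
            * (digamma (α' a) * x a - Real.log (Real.Gamma (x a))) := by
      rw [← Finset.sum_fiberwise Finset.univ υ, ← Finset.sum_add_distrib]
      refine Finset.sum_congr rfl fun a _ => ?_
      have hn : ((Finset.univ.filter (fun κ => υ κ = a)).card : ℝ) ≠ 0 := by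
        obtain ⟨κ, hκ⟩ := hυ a
        exact_mod_cast (Finset.card_pos.mpr ⟨κ, by simp [hκ]⟩).ne'
      have hsum : ∑ κ with υ κ = a,
            (x (υ κ) * Real.log (β (ω κ)) - Real.log (Real.Gamma (x (υ κ))))
          = ∑ κ with υ κ = a, (x a * Real.log (β (ω κ)) - Real.log (Real.Gamma (x a))) :=
        Finset.sum_congr rfl fun κ hκ => by rw [(Finset.mem_filter.mp hκ).2]
      have hψ := hupdα a
      rw [eq_div_iff hn] at hψ
      rw [hsum, Finset.sum_sub_distrib, ← Finset.mul_sum, Finset.sum_const, nsmul_eq_mul]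
      linear_combination -x a * hψ
    rw [fiber α, fiber α']
    refine Finset.sum_le_sum fun a _ => mul_le_mul_of_nonneg_left ?_ (Nat.cast_nonneg _)
    linarith [log_Gamma_add_digamma_mul_le (hα' a) (hα a)]
  have hstepβ : ∑ κ : K, α' (υ κ) * Real.log (β (ω κ)) - ∑ b : B, δ b * β b
      ≤ ∑ κ : K, α' (υ κ) * Real.log (β' (ω κ)) - ∑ b : B, δ b * β' b := by
    have fiber (y : B → ℝ) :
        ∑ κ : K, α' (υ κ) * Real.log (y (ω κ)) - ∑ b : B, δ b * y b
        = ∑ b : B, (δ b * β' b * Real.log (y b) - δ b * y b) := by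
      rw [← Finset.sum_fiberwise Finset.univ ω, ← Finset.sum_sub_distrib]
      refine Finset.sum_congr rfl fun b _ => ?_
      rw [hβ' b, mul_div_cancel₀ _ (hδ b).ne', Finset.sum_mul]
      congr 1
      exact Finset.sum_congr rfl fun κ hκ => by rw [(Finset.mem_filter.mp hκ).2]
    rw [fiber β, fiber β']
    refine Finset.sum_le_sum fun b _ => mul_log_sub_mul_le (hδ b) ?_ (hβ b)
    rw [hβ' b]
    obtain ⟨κ, hκ⟩ := hω b
    exact div_pos (Finset.sum_pos (fun κ _ => hα' (υ κ)) ⟨κ, by simp [hκ]⟩) (hδ b)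
  simp only [Finset.sum_sub_distrib] at hstepα ⊢
  linarith
end

section
/- Let S, I, K be nonempty finite sets, A a finite set, and φ : (S × I × K) → A a surjective map. Let ξ : A → ℝ be given. For α : A → (0,∞), define H(α) = ∑_{k∈K} ( ln Γ(∑_{(s,i)∈S×I} α(φ(s,i,k))) − ∑_{(s,i)∈S×I} ln Γ(α(φ(s,i,k))) ) + ∑_{a∈A} ξ(a)·α(a). Suppose α : A → (0,∞) is given and α' : A → (0,∞) satisfies, for every a ∈ A, ψ(α'(a)) = ( ∑_{(s,i,k)∈φ⁻¹(a)} ψ(∑_{(s',i')∈S×I} α(φ(s',i',k))) + ξ(a) ) / |φ⁻¹(a)|. Then H(α') ≥ H(α). (Proposition 2: the Dirichlet-prior hyperparameter update makes the normalized ELBO non-decreasing.) -/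
theorem hasDerivAt_log_Gamma {x : ℝ} (hx : 0 < x) :
    HasDerivAt (fun y : ℝ => Real.log (Real.Gamma y)) (digamma x) x :=
  ((Real.differentiableAt_Gamma fun m => (by linarith [m.cast_nonneg (α := ℝ)] : -(m : ℝ) < x).ne').log (Real.Gamma_pos_of_pos hx).ne').hasDerivAt

/-- The tangent-line inequality for the convex function `ln Γ`. -/
theorem digamma_mul_sub_le {x y : ℝ} (hx : 0 < x) (hy : 0 < y) :
    digamma x * (y - x) ≤ Real.log (Real.Gamma y) - Real.log (Real.Gamma x) := by
  have hc : ConvexOn ℝ (Set.Ioi 0) fun y : ℝ => Real.log (Real.Gamma y) :=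
    Real.convexOn_log_Gamma
  have hd := hasDerivAt_log_Gamma hx
  rcases lt_trichotomy x y with h | rfl | h
  · have := hc.le_slope_of_hasDerivAt hx hy h hd
    rwa [slope_def_field, le_div_iff₀ (sub_pos.2 h)] at this
  · simp
  · have := hc.slope_le_of_hasDerivAt hy hx h hd
    rw [slope_def_field, div_le_iff₀ (sub_pos.2 h)] at this
    linarith

theorem Fintype.sum_sum_prod_assoc {S I K M : Type*} [Fintype S] [Fintype I] [Fintype K]
    [AddCommMonoid M] (f : S × I × K → M) :
    ∑ k : K, ∑ q : S × I, f (q.1, q.2, k) = ∑ p : S × I × K, f p := by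
  rw [Finset.sum_comm]
  simp only [Fintype.sum_prod_type]

/-- Proposition 2: the Dirichlet-prior hyperparameter update makes the normalized ELBO
`H(α) = ∑_k (ln Γ(∑_{(s,i)} α(φ(s,i,k))) − ∑_{(s,i)} ln Γ(α(φ(s,i,k)))) + ∑_a ξ(a)·α(a)`
non-decreasing. -/
theorem dirichlet_hyperparameter_update_nondecreasing
    {S I K A : Type*} [Fintype S] [Fintype I] [Fintype K] [Fintype A]
    [Nonempty S] [Nonempty I] [Nonempty K] [DecidableEq A]
    (φ : S × I × K → A) (hφ : Function.Surjective φ)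
    (ξ : A → ℝ)
    (α : A → ℝ) (hα : ∀ a, 0 < α a)
    (α' : A → ℝ) (hα' : ∀ a, 0 < α' a)
    (hupd : ∀ a, digamma (α' a)
      = ((∑ p ∈ Finset.univ.filter (fun p : S × I × K => φ p = a),
            digamma (∑ q : S × I, α (φ (q.1, q.2, p.2.2)))) + ξ a)
          / ((Finset.univ.filter (fun p : S × I × K => φ p = a)).card : ℝ)) :
    (∑ k : K, (Real.log (Real.Gamma (∑ q : S × I, α (φ (q.1, q.2, k))))
          - ∑ q : S × I, Real.log (Real.Gamma (α (φ (q.1, q.2, k))))))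
        + ∑ a : A, ξ a * α a
      ≤ (∑ k : K, (Real.log (Real.Gamma (∑ q : S × I, α' (φ (q.1, q.2, k))))
          - ∑ q : S × I, Real.log (Real.Gamma (α' (φ (q.1, q.2, k))))))
        + ∑ a : A, ξ a * α' a := by
  set c : K → ℝ := fun k => digamma (∑ q : S × I, α (φ (q.1, q.2, k)))
  have hsum : ∀ β : A → ℝ, (∀ a, 0 < β a) → ∀ k, 0 < ∑ q : S × I, β (φ (q.1, q.2, k)) :=
    fun β hβ k => Finset.sum_pos (fun q _ => hβ _) Finset.univ_nonempty
  have hlin : ∑ k, c k * (∑ q : S × I, α' (φ (q.1, q.2, k)) - ∑ q : S × I, α (φ (q.1, q.2, k)))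
      ≤ ∑ k, (Real.log (Real.Gamma (∑ q : S × I, α' (φ (q.1, q.2, k))))
        - Real.log (Real.Gamma (∑ q : S × I, α (φ (q.1, q.2, k))))) :=
    Finset.sum_le_sum fun k _ => digamma_mul_sub_le (hsum α hα k) (hsum α' hα' k)
  have hcat : ∑ p, digamma (α' (φ p)) * (α (φ p) - α' (φ p))
      ≤ ∑ p, (Real.log (Real.Gamma (α (φ p))) - Real.log (Real.Gamma (α' (φ p)))) :=
    Finset.sum_le_sum fun p _ => digamma_mul_sub_le (hα' _) (hα _)
  have hc : ∑ k, c k * (∑ q : S × I, α' (φ (q.1, q.2, k)) - ∑ q : S × I, α (φ (q.1, q.2, k)))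
      = ∑ p : S × I × K, c p.2.2 * (α' (φ p) - α (φ p)) := by
    rw [← Fintype.sum_sum_prod_assoc]
    simp only [← Finset.sum_sub_distrib, Finset.mul_sum]
  have hfib : ∑ p, digamma (α' (φ p)) * (α (φ p) - α' (φ p))
      = ∑ p : S × I × K, c p.2.2 * (α (φ p) - α' (φ p)) + ∑ a, ξ a * (α a - α' a) := by
    rw [← Finset.sum_fiberwise Finset.univ φ, ← Finset.sum_fiberwise Finset.univ φ
      (fun p => c p.2.2 * (α (φ p) - α' (φ p))), ← Finset.sum_add_distrib]
    refine Finset.sum_congr rfl fun a _ => ?_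
    have hcard : ((Finset.univ.filter fun p => φ p = a).card : ℝ) ≠ 0 := by
      obtain ⟨p, hp⟩ := hφ a
      exact_mod_cast (Finset.card_pos.2 ⟨p, by simp [hp]⟩).ne'
    have hfiber : ∀ g : S × I × K → ℝ, ∀ h : A → ℝ,
        ∑ p ∈ Finset.univ.filter (fun p => φ p = a), g p * h (φ p)
          = (∑ p ∈ Finset.univ.filter (fun p => φ p = a), g p) * h a := fun g h => by
      rw [Finset.sum_mul]
      exact Finset.sum_congr rfl fun p hp => by rw [(Finset.mem_filter.1 hp).2]
    have hconst : ∑ p ∈ Finset.univ.filter (fun p => φ p = a), digamma (α' (φ p))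
        = ∑ p ∈ Finset.univ.filter (fun p => φ p = a), c p.2.2 + ξ a := by
      rw [Finset.sum_congr rfl fun p hp => by rw [(Finset.mem_filter.1 hp).2],
        Finset.sum_const, nsmul_eq_mul, hupd a, mul_div_cancel₀ _ hcard]
    rw [hfiber _ fun b => α b - α' b, hfiber _ fun b => α b - α' b, hconst, add_mul]
  have hassoc : ∀ β : A → ℝ, ∑ k, ∑ q : S × I, Real.log (Real.Gamma (β (φ (q.1, q.2, k))))
      = ∑ p, Real.log (Real.Gamma (β (φ p))) :=
    fun β => Fintype.sum_sum_prod_assoc fun p => Real.log (Real.Gamma (β (φ p)))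
  rw [hc] at hlin
  rw [hfib] at hcat
  simp only [Finset.sum_sub_distrib, mul_sub, hassoc] at hlin hcat ⊢
  linarith
end
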